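/- If A and B are strongly contiguous stepping sequences for m−1 (with m ≥ 3), then (A+1) ++ [1, 2, …, m−1] ++ B is a strongly contiguous stepping sequence for m, where A+1 denotes the list obtained by adding 1 to each entry of A. Consequently, R_m is a strongly contiguous stepping sequence for every m ≥ 2. -/

import Mathlib

open List

/-- The initial configuration `(1, 2, …, m)`. -/
def initConfig (m : ℕ) : List ℕ := (List.range m).map (· + 1)

/-- A move at index `i` (with `1 ≤ i ≤ m-1`) transposes the entries `q_i` and `q_{i+1}`
(one-indexed), i.e. the entries at zero-indexed positions `i-1` and `i`. -/
def swapAdj (q : List ℕ) (i : ℕ) : List ℕ :=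
  (q.set (i - 1) (q.getD i 0)).set i (q.getD (i - 1) 0)

/-- The prefix set `S_k(q) = {q_1, …, q_k}`. -/
def prefixSet (q : List ℕ) (k : ℕ) : Finset ℕ := (q.take k).toFinset

/-- The initial prefix sets `S_0 ⊂ S_1 ⊂ … ⊂ S_m` of the configuration `(1,…,m)`. -/
def initSets (m : ℕ) : List (Finset ℕ) :=
  (List.range (m + 1)).map (fun k => prefixSet (initConfig m) k)

/-- The sets generated by applying a sequence of moves starting from configuration `q`:
the `t`-th generated set is the prefix set of length `i_t` of the configuration
obtained after the `t`-th move. -/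
def genSetsAux (q : List ℕ) : List ℕ → List (Finset ℕ)
  | [] => []
  | i :: rest => prefixSet (swapAdj q i) i :: genSetsAux (swapAdj q i) rest

/-- The sets generated by the moves, starting from the initial configuration `(1,…,m)`. -/
def genSets (m : ℕ) (moves : List ℕ) : List (Finset ℕ) :=
  genSetsAux (initConfig m) moves

/-- `moves` is a stepping sequence for `m`: each move index lies in `{1,…,m-1}`, and the
initial prefix sets `S_0,…,S_m` together with the generated sets list every subset of
`{1,…,m}` exactly once. -/
def IsSteppingSeq (m : ℕ) (moves : List ℕ) : Prop :=
  (∀ i ∈ moves, 1 ≤ i ∧ i ≤ m - 1) ∧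
  (initSets m ++ genSets m moves).Perm (Finset.Icc 1 m).powerset.toList

/-- `R_2 = [1]` and `R_m = (R_{m-1}+1) ++ [1,2,…,m-1] ++ R_{m-1}` for `m ≥ 3`. -/
def Rseq : ℕ → List ℕ
  | 0 => []
  | 1 => []
  | 2 => [1]
  | m + 3 => (Rseq (m + 2)).map (· + 1) ++ (List.range (m + 2)).map (· + 1) ++ Rseq (m + 2)

/-- A list of moves is contiguous if consecutive entries differ by exactly 1. -/
def ContiguousList (G : List ℕ) : Prop :=
  ∀ t, t + 1 < G.length → ((G.getD t 0 : ℤ) - (G.getD (t + 1) 0 : ℤ)).natAbs = 1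

/-- A stepping sequence for `m` is strongly contiguous if it is contiguous, begins
with `m-1`, and ends with `1`. -/
def StronglyContiguous (m : ℕ) (G : List ℕ) : Prop :=
  ContiguousList G ∧ G.head? = some (m - 1) ∧ G.getLast? = some 1

theorem swapAdj_cons_cons_one (a b : ℕ) (q : List ℕ) : swapAdj (a :: b :: q) 1 = b :: a :: q := by
  simp [swapAdj]

theorem swapAdj_cons_succ (a : ℕ) (q : List ℕ) {i : ℕ} (hi : 1 ≤ i) :
    swapAdj (a :: q) (i + 1) = a :: swapAdj q i := by
  obtain ⟨j, rfl⟩ := Nat.exists_eq_add_of_le' hi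
  simp [swapAdj]

theorem swapAdj_map (f : ℕ → ℕ) (q : List ℕ) {i : ℕ} (hi : i < q.length) :
    swapAdj (q.map f) i = (swapAdj q i).map f := by
  have hi' : i - 1 < q.length := by omega
  simp [swapAdj, List.map_set, List.getElem?_eq_getElem hi, List.getElem?_eq_getElem hi']

theorem swapAdj_append (q r : List ℕ) {i : ℕ} (hi : i < q.length) :
    swapAdj (q ++ r) i = swapAdj q i ++ r := by
  have hi' : i - 1 < q.length := by omega
  simp [swapAdj, List.getElem?_append, hi, hi']

@[simp] theorem length_swapAdj (q : List ℕ) (i : ℕ) : (swapAdj q i).length = q.length := by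
  simp [swapAdj]

theorem swapAdj_perm (q : List ℕ) {i : ℕ} (hi : 1 ≤ i) (hiq : i < q.length) :
    (swapAdj q i).Perm q := by
  induction q generalizing i with
  | nil => simp at hiq
  | cons a q ih =>
    obtain ⟨j, rfl⟩ := Nat.exists_eq_add_of_le' hi
    rcases Nat.eq_zero_or_pos j with rfl | hj
    · cases q with
      | nil => simp at hiq
      | cons b q => simpa [swapAdj_cons_cons_one] using List.Perm.swap a b q
    · rw [swapAdj_cons_succ a q hj]
      exact (ih hj (by simpa using hiq)).cons a

theorem foldl_swapAdj_perm (q l : List ℕ) (hl : ∀ i ∈ l, 1 ≤ i ∧ i < q.length) :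
    (l.foldl swapAdj q).Perm q := by
  induction l generalizing q with
  | nil => simp
  | cons i l ih =>
    obtain ⟨⟨hi, hiq⟩, hl⟩ := List.forall_mem_cons.1 hl
    exact (ih (swapAdj q i) (by simpa using hl)).trans (swapAdj_perm q hi hiq)

theorem foldl_swapAdj_cons (a : ℕ) (q l : List ℕ) (hl : ∀ i ∈ l, 1 ≤ i) :
    (l.map (· + 1)).foldl swapAdj (a :: q) = a :: l.foldl swapAdj q := by
  induction l generalizing q with
  | nil => rfl
  | cons i l ih =>
    obtain ⟨hi, hl⟩ := List.forall_mem_cons.1 hl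
    simp [swapAdj_cons_succ a q hi, ih _ hl]

theorem prefixSet_cons_succ (a : ℕ) (q : List ℕ) (k : ℕ) :
    prefixSet (a :: q) (k + 1) = insert a (prefixSet q k) := by
  simp [prefixSet]

@[simp] theorem prefixSet_zero (q : List ℕ) : prefixSet q 0 = ∅ := by
  simp [prefixSet]

theorem prefixSet_map (f : ℕ → ℕ) (q : List ℕ) (k : ℕ) :
    prefixSet (q.map f) k = (prefixSet q k).image f := by
  ext x
  simp [prefixSet, ← List.map_take]

theorem genSetsAux_append (q l₁ l₂ : List ℕ) :
    genSetsAux q (l₁ ++ l₂) = genSetsAux q l₁ ++ genSetsAux (l₁.foldl swapAdj q) l₂ := by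
  induction l₁ generalizing q with
  | nil => rfl
  | cons i l ih => simp [genSetsAux, ih]

theorem genSetsAux_cons (a : ℕ) (q l : List ℕ) (hl : ∀ i ∈ l, 1 ≤ i) :
    genSetsAux (a :: q) (l.map (· + 1)) = (genSetsAux q l).map (insert a) := by
  induction l generalizing q with
  | nil => rfl
  | cons i l ih =>
    obtain ⟨hi, hl⟩ := List.forall_mem_cons.1 hl
    simp [genSetsAux, swapAdj_cons_succ a q hi, prefixSet_cons_succ, ih _ hl]

theorem genSetsAux_map (f : ℕ → ℕ) (q l : List ℕ) (hl : ∀ i ∈ l, i < q.length) :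
    genSetsAux (q.map f) l = (genSetsAux q l).map (Finset.image f) := by
  induction l generalizing q with
  | nil => rfl
  | cons i l ih =>
    obtain ⟨hi, hl⟩ := List.forall_mem_cons.1 hl
    simp [genSetsAux, swapAdj_map f q hi, prefixSet_map, ih (swapAdj q i) (by simpa using hl)]

theorem genSetsAux_append_left (q r l : List ℕ) (hl : ∀ i ∈ l, i < q.length) :
    genSetsAux (q ++ r) l = genSetsAux q l := by
  induction l generalizing q with
  | nil => rfl
  | cons i l ih =>
    obtain ⟨hi, hl⟩ := List.forall_mem_cons.1 hl
    simp [genSetsAux, swapAdj_append q r hi, ih (swapAdj q i) (by simpa using hl), prefixSet,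
      List.take_append_of_le_length, hi.le]

theorem map_range_succ_eq_cons (n : ℕ) :
    (List.range (n + 1)).map (· + 1) = 1 :: ((List.range n).map (· + 1)).map (· + 1) := by
  simp [List.range_succ_eq_map]

theorem foldl_swapAdj_sweep (a : ℕ) (q : List ℕ) :
    ((List.range q.length).map (· + 1)).foldl swapAdj (a :: q) = q ++ [a] := by
  induction q with
  | nil => rfl
  | cons b q ih =>
    rw [List.length_cons, map_range_succ_eq_cons, List.foldl_cons, swapAdj_cons_cons_one,
      foldl_swapAdj_cons _ _ _ (by simp), ih, List.cons_append]

theorem genSetsAux_sweep (a : ℕ) (q : List ℕ) :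
    genSetsAux (a :: q) ((List.range q.length).map (· + 1)) =
      (List.range q.length).map (fun k => prefixSet q (k + 1)) := by
  induction q with
  | nil => rfl
  | cons b q ih =>
    rw [List.length_cons, map_range_succ_eq_cons, genSetsAux, swapAdj_cons_cons_one,
      genSetsAux_cons _ _ _ (by simp), ih]
    simp [List.range_succ_eq_map, prefixSet_cons_succ]

theorem initConfig_succ (n : ℕ) : initConfig (n + 1) = 1 :: (initConfig n).map (· + 1) :=
  map_range_succ_eq_cons n

@[simp] theorem length_initConfig (n : ℕ) : (initConfig n).length = n := by
  simp [initConfig]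

theorem initConfig_nodup (n : ℕ) : (initConfig n).Nodup :=
  List.nodup_range.map (add_left_injective 1)

theorem toFinset_initConfig (n : ℕ) : (initConfig n).toFinset = Finset.Icc 1 n := by
  ext x
  simp only [initConfig, List.mem_toFinset, List.mem_map, List.mem_range, Finset.mem_Icc]
  exact ⟨by rintro ⟨y, hy, rfl⟩; omega, fun h => ⟨x - 1, by omega, by omega⟩⟩

theorem map_getD_initConfig (q : List ℕ) :
    (initConfig q.length).map (fun i => q.getD (i - 1) 0) = q := by
  refine List.ext_getElem (by simp) fun i h₁ h₂ => ?_
  simp [initConfig, h₂]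

theorem powerset_toList_map_image {f : ℕ → ℕ} {S : Finset ℕ} (hf : Set.InjOn f S) :
    (S.powerset.toList.map (Finset.image f)).Perm (S.image f).powerset.toList := by
  refine (List.perm_ext_iff_of_nodup ?_ (Finset.nodup_toList _)).2 fun s => ?_
  · refine List.Nodup.map_on (fun s hs t ht h => ?_) (Finset.nodup_toList _)
    simp only [Finset.mem_toList, Finset.mem_powerset] at hs ht
    exact (Finset.image_injOn_powerset_of_injOn hf) (by simpa using hs) (by simpa using ht) h
  · simp [Finset.subset_image_iff]

theorem powerset_insert_toList_perm {a : ℕ} {S : Finset ℕ} (ha : a ∉ S) :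
    (S.powerset.toList.map (insert a) ++ S.powerset.toList).Perm
      (insert a S).powerset.toList := by
  have hS : ∀ s ∈ S.powerset.toList, a ∉ s := fun s hs h =>
    ha ((by simpa using hs : s ⊆ S) h)
  refine (List.perm_ext_iff_of_nodup ?_ (Finset.nodup_toList _)).2 fun s => ?_
  · refine List.nodup_append.2 ⟨?_, Finset.nodup_toList _, ?_⟩
    · refine List.Nodup.map_on (fun s hs t ht h => ?_) (Finset.nodup_toList _)
      rw [← Finset.erase_insert (hS s hs), h, Finset.erase_insert (hS t ht)]
    · intro s hs t ht hst
      obtain ⟨u, -, rfl⟩ := List.mem_map.1 hs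
      exact hS t ht (hst ▸ Finset.mem_insert_self a u)
  · simp [Finset.powerset_insert, or_comm]

/-- Relabelling the ground set: a stepping sequence run from any configuration `q` without
repetitions lists every subset of the ground set of `q`. -/
theorem IsSteppingSeq.perm_powerset {q l : List ℕ} (hq : q.Nodup)
    (hl : IsSteppingSeq q.length l) (hlt : ∀ i ∈ l, i < q.length) :
    ((List.range (q.length + 1)).map (prefixSet q) ++ genSetsAux q l).Perm
      q.toFinset.powerset.toList := by
  set f : ℕ → ℕ := fun i => q.getD (i - 1) 0 with hf
  have hmap : (initConfig q.length).map f = q := map_getD_initConfig q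
  have hinj : Set.InjOn f (Finset.Icc 1 q.length) := by
    intro x hx y hy hxy
    rw [← hmap] at hq
    refine List.inj_on_of_nodup_map hq ?_ ?_ hxy <;>
      rwa [← List.mem_toFinset, toFinset_initConfig]
  have himg : (Finset.Icc 1 q.length).image f = q.toFinset := by
    conv_rhs => rw [← hmap]
    rw [← toFinset_initConfig]
    ext x
    simp
  have h := (hl.2.map (Finset.image f)).trans (powerset_toList_map_image hinj)
  rw [himg, List.map_append, genSets, ← genSetsAux_map _ _ _ (by simpa using hlt), hmap,
    initSets, List.map_map] at h
  convert h using 3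
  funext k
  simp [← prefixSet_map, hmap]

theorem IsSteppingSeq.append_sweep {n : ℕ} {A B : List ℕ} (hn : 1 ≤ n)
    (hA : IsSteppingSeq n A) (hB : IsSteppingSeq n B) :
    IsSteppingSeq (n + 1) (A.map (· + 1) ++ (List.range n).map (· + 1) ++ B) := by
  refine ⟨fun i hi => ?_, ?_⟩
  · simp only [List.mem_append, List.mem_map, List.mem_range] at hi
    rcases hi with (⟨j, hj, rfl⟩ | ⟨j, hj, rfl⟩) | hi
    · have := hA.1 j hj; omega
    · omega
    · have := hB.1 i hi; omega
  have hA1 : ∀ i ∈ A, 1 ≤ i := fun i hi => (hA.1 i hi).1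
  have hAn : ∀ i ∈ A, i < n := fun i hi => by have := hA.1 i hi; omega
  have hBn : ∀ i ∈ B, i < n := fun i hi => by have := hB.1 i hi; omega
  set q := (initConfig n).map (· + 1) with hq
  have hqn : q.length = n := by simp [hq]
  have hqnd : q.Nodup := (initConfig_nodup n).map (add_left_injective 1)
  set r := A.foldl swapAdj q with hr
  have hrq : r.Perm q :=
    foldl_swapAdj_perm q A fun i hi => ⟨hA1 i hi, by rw [hqn]; exact hAn i hi⟩
  have hrn : r.length = n := hrq.length_eq.trans hqn
  have hgen : genSets (n + 1) (A.map (· + 1) ++ (List.range n).map (· + 1) ++ B) =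
      (genSetsAux q A).map (insert 1) ++ (List.range n).map (fun k => prefixSet r (k + 1)) ++
        genSetsAux r B := by
    rw [genSets, initConfig_succ, genSetsAux_append, genSetsAux_append, List.foldl_append,
      genSetsAux_cons _ _ _ hA1, foldl_swapAdj_cons _ _ _ hA1]
    have h₁ := genSetsAux_sweep 1 r
    have h₂ := foldl_swapAdj_sweep 1 r
    rw [hrn] at h₁ h₂
    rw [h₁, h₂, genSetsAux_append_left _ _ _ (by rwa [hrn])]
  have hinit : initSets (n + 1) =
      ∅ :: ((List.range (n + 1)).map (prefixSet q)).map (insert 1) := by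
    rw [initSets, initConfig_succ, List.range_succ_eq_map]
    simp [prefixSet_cons_succ, ← hq, Function.comp_def]
  have hpre : (List.range (n + 1)).map (prefixSet r) =
      ∅ :: (List.range n).map (fun k => prefixSet r (k + 1)) := by
    simp [List.range_succ_eq_map, Function.comp_def]
  have hqA := IsSteppingSeq.perm_powerset hqnd (by rwa [hqn]) (by rwa [hqn] : ∀ i ∈ A, _)
  have hrB := IsSteppingSeq.perm_powerset (hrq.nodup_iff.2 hqnd) (by rwa [hrn])
    (by rwa [hrn] : ∀ i ∈ B, _)
  rw [hqn] at hqA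
  rw [hrn, hpre, List.toFinset_eq_of_perm _ _ hrq] at hrB
  have hIcc : Finset.Icc 1 (n + 1) = insert 1 q.toFinset := by
    rw [← toFinset_initConfig, initConfig_succ, List.toFinset_cons]
  have h1 : 1 ∉ q.toFinset := by simp [hq, initConfig]
  rw [hIcc, hgen, hinit]
  refine List.Perm.trans ?_ (powerset_insert_toList_perm h1)
  refine List.Perm.trans ?_ ((hqA.map (insert 1)).append hrB)
  rw [List.map_append, ← Multiset.coe_eq_coe]
  simp only [← Multiset.coe_add, ← Multiset.cons_coe, ← Multiset.singleton_add]
  abel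

theorem contiguousList_iff_isChain (G : List ℕ) :
    ContiguousList G ↔ G.IsChain fun a b : ℕ => ((a : ℤ) - b).natAbs = 1 := by
  rw [List.isChain_iff_getElem]
  refine forall_congr' fun t => forall_congr' fun ht => ?_
  rw [List.getD_eq_getElem _ _ ht, List.getD_eq_getElem _ _ (Nat.lt_of_succ_lt ht)]

theorem StronglyContiguous.append_sweep {n : ℕ} {A B : List ℕ} (hn : 2 ≤ n)
    (hA : StronglyContiguous n A) (hB : StronglyContiguous n B) :
    StronglyContiguous (n + 1) (A.map (· + 1) ++ (List.range n).map (· + 1) ++ B) := by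
  obtain ⟨hAc, hAh, hAl⟩ := hA
  obtain ⟨hBc, hBh, hBl⟩ := hB
  rw [contiguousList_iff_isChain] at hAc hBc
  obtain ⟨k, rfl⟩ := Nat.exists_eq_add_of_le' hn
  have hhead : ((List.range (k + 2)).map (· + 1)).head? = some 1 := by
    simp [List.range_succ_eq_map]
  have hlast : ((List.range (k + 2)).map (· + 1)).getLast? = some (k + 2) := by
    simp [List.range_succ]
  refine ⟨?_, by simp [hAh], by simp [hBl]⟩
  rw [contiguousList_iff_isChain, List.isChain_append, List.isChain_append]
  refine ⟨⟨?_, ?_, ?_⟩, hBc, ?_⟩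
  · rw [List.isChain_map]
    simpa using hAc
  · rw [List.isChain_iff_getElem]
    intro i hi
    simp
  · rw [hhead, List.getLast?_map, hAl]
    simp
  · rw [List.getLast?_append, hlast, hBh]
    simp

theorem isSteppingSeq_two : IsSteppingSeq 2 [1] := by
  refine ⟨by simp, ?_⟩
  rw [← Multiset.coe_eq_coe, Finset.coe_toList]
  decide

theorem stronglyContiguous_two : StronglyContiguous 2 [1] := by
  simp [StronglyContiguous, ContiguousList]

/-- Theorem 6.2: if `A` and `B` are strongly contiguous stepping sequences for `m-1`
(with `m ≥ 3`), then `(A+1) ++ [1,2,…,m-1] ++ B` is a strongly contiguous stepping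
sequence for `m`; consequently `R_m` is a strongly contiguous stepping sequence for
every `m ≥ 2`. -/
theorem stronglyContiguous_recursion_and_Rseq :
    (∀ m : ℕ, 3 ≤ m → ∀ A B : List ℕ,
      IsSteppingSeq (m - 1) A → StronglyContiguous (m - 1) A →
      IsSteppingSeq (m - 1) B → StronglyContiguous (m - 1) B →
      IsSteppingSeq m (A.map (· + 1) ++ (List.range (m - 1)).map (· + 1) ++ B) ∧
        StronglyContiguous m (A.map (· + 1) ++ (List.range (m - 1)).map (· + 1) ++ B)) ∧
    (∀ m : ℕ, 2 ≤ m → IsSteppingSeq m (Rseq m) ∧ StronglyContiguous m (Rseq m)) := by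
  have hrec : ∀ n : ℕ, 2 ≤ n → ∀ A B : List ℕ,
      IsSteppingSeq n A ∧ StronglyContiguous n A → IsSteppingSeq n B ∧ StronglyContiguous n B →
      IsSteppingSeq (n + 1) (A.map (· + 1) ++ (List.range n).map (· + 1) ++ B) ∧
        StronglyContiguous (n + 1) (A.map (· + 1) ++ (List.range n).map (· + 1) ++ B) :=
    fun n hn A B hA hB =>
      ⟨hA.1.append_sweep (by omega) hB.1, hA.2.append_sweep hn hB.2⟩
  refine ⟨fun m hm A B hA hA' hB hB' => ?_, fun m hm => ?_⟩
  · obtain ⟨n, rfl⟩ := Nat.exists_eq_add_of_le' (show 1 ≤ m by omega)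
    exact hrec n (by omega) A B ⟨hA, hA'⟩ ⟨hB, hB'⟩
  · induction m, hm using Nat.le_induction with
    | base => exact ⟨isSteppingSeq_two, stronglyContiguous_two⟩
    | succ n hn ih =>
      obtain ⟨k, rfl⟩ := Nat.exists_eq_add_of_le' hn
      exact hrec (k + 2) hn _ _ ih ih
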